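/- Let κ > 0 and μ ∈ ℝ. Then (1 + e^{-μ})^{-κ} = ∫_0^∞ Φ( (μ + (1/2)(1−κ)λ) / √λ ) · q_{1,κ}(λ) dλ. (This is the paper's alternate single-integral representation of the powered logistic function, obtained from Theorem 1 by interchanging the order of integration, with μ playing the role of yᵢxᵢᵀβ.) -/

import Mathlib

/-- The Euler Beta function `B(a,b) = Γ(a)Γ(b)/Γ(a+b)`. -/
noncomputable def betaFn (a b : ℝ) : ℝ := Real.Gamma a * Real.Gamma b / Real.Gamma (a + b)

/-- The weights `w_k` of the Polya density: with `δ = (a+b)/2`,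
`w_k = (-1)^k (2δ)(2δ+1)⋯(2δ+k-1)/k! · (δ+k)/B(a,b)`. -/
noncomputable def polyaWeight (a b : ℝ) (k : ℕ) : ℝ :=
  (-1 : ℝ) ^ k * (∏ i ∈ Finset.range k, (a + b + i)) / (Nat.factorial k) *
    ((a + b) / 2 + k) / betaFn a b

/-- The Polya density `q_{a,b}(λ) = Σ_{k=0}^∞ w_k exp(-ψ_k λ/2)` with
`ψ_k = (a+k)(b+k)`. -/
noncomputable def polya (a b lam : ℝ) : ℝ :=
  ∑' k : ℕ, polyaWeight a b k * Real.exp (-((a + k) * (b + k) * lam / 2))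

/-- The standard normal cumulative distribution function. -/
noncomputable def Phi (x : ℝ) : ℝ :=
  ∫ t in Set.Iic x, (2 * Real.pi) ^ (-(1 : ℝ) / 2) * Real.exp (-t ^ 2 / 2)

open MeasureTheory ProbabilityTheory Filter Topology Set

/-- The coefficients `(-1)^k (r)_k / k!` of the expansion of `(1 + z)^(-r)`. -/
noncomputable def negBinomCoeff (r : ℝ) (k : ℕ) : ℝ :=
  (-1 : ℝ) ^ k * (∏ i ∈ Finset.range k, (r + i)) / (Nat.factorial k)

theorem negBinomCoeff_succ (r : ℝ) (k : ℕ) :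
    negBinomCoeff r (k + 1) * (k + 1) = -r * negBinomCoeff (r + 1) k := by
  simp only [negBinomCoeff, Finset.prod_range_succ', Nat.factorial_succ]
  push_cast
  field_simp
  rw [Finset.prod_congr rfl fun (i : ℕ) _ => show r + ((i : ℝ) + 1) = r + 1 + i by ring]
  ring

theorem ringChoose_neg_eq_negBinomCoeff (r : ℝ) (k : ℕ) :
    Ring.choose (-r) k = negBinomCoeff r k := by
  have h : ∀ k : ℕ, (descPochhammer ℤ k).smeval (-r) =
      (-1 : ℝ) ^ k * ∏ i ∈ Finset.range k, (r + i) := by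
    intro k
    induction k with
    | zero => simp
    | succ k ih =>
      rw [descPochhammer_succ_right, Polynomial.smeval_mul, ih, Finset.prod_range_succ]
      simp [Polynomial.smeval_natCast, Polynomial.smeval_sub]
      ring
  rw [Ring.choose_eq_smul, h, negBinomCoeff, smul_eq_mul]
  ring

theorem hasSum_negBinomCoeff (r : ℝ) {z : ℂ} (hz : ‖z‖ < 1) :
    HasSum (fun k : ℕ => (negBinomCoeff r k : ℂ) * z ^ k) ((1 + z) ^ ((-r : ℝ) : ℂ)) := by
  have h := (Complex.one_add_cpow_hasFPowerSeriesOnBall_zero (a := ((-r : ℝ) : ℂ))).hasSum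
    (y := z) (by simpa [Metric.mem_eball, edist_zero_right, enorm_eq_nnnorm, ← NNReal.coe_lt_one] using hz)
  simp only [binomialSeries_apply, List.ofFn_const, List.prod_replicate, zero_add,
    smul_eq_mul, ← Complex.ofReal_choose, ringChoose_neg_eq_negBinomCoeff] at h
  exact h

theorem hasSum_polyaCoeff (r : ℝ) {z : ℂ} (hz : ‖z‖ < 1) :
    HasSum (fun k : ℕ => ((negBinomCoeff r k * (r / 2 + k) : ℝ) : ℂ) * z ^ k)
      ((r / 2 : ℂ) * (1 + z) ^ ((-r : ℝ) : ℂ) - r * z * (1 + z) ^ ((-(r + 1) : ℝ) : ℂ)) := by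
  have h1 := (hasSum_negBinomCoeff r hz).mul_left (r / 2 : ℂ)
  have h2 : HasSum (fun k : ℕ => ((negBinomCoeff r k * k : ℝ) : ℂ) * z ^ k)
      (-(r * z * (1 + z) ^ ((-(r + 1) : ℝ) : ℂ))) := by
    rw [← hasSum_nat_add_iff' 1]
    have := (hasSum_negBinomCoeff (r + 1) hz).mul_left (-r * z)
    convert! this using 1
    · ext k
      have hk := negBinomCoeff_succ r k
      have hk' : ((negBinomCoeff r (k + 1) * ((k + 1 : ℕ) : ℝ) : ℝ) : ℂ) =
          -r * negBinomCoeff (r + 1) k := by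
        push_cast
        exact_mod_cast hk
      rw [hk']
      ring
    · simp
  convert! h1.add h2 using 1
  ext k
  push_cast
  ring

theorem summable_abs_negBinomCoeff (r : ℝ) {x : ℝ} (h0 : 0 ≤ x) (h1 : x < 1) :
    Summable fun k : ℕ => |negBinomCoeff r k| * x ^ k := by
  have h := (hasSum_negBinomCoeff r (z := x) (by simpa [abs_of_nonneg h0] using h1)).summable.norm
  simpa [abs_of_nonneg h0] using h

theorem summable_abs_polyaCoeff (r : ℝ) {x : ℝ} (h0 : 0 ≤ x) (h1 : x < 1) :
    Summable fun k : ℕ => |negBinomCoeff r k * (r / 2 + k)| * x ^ k := by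
  have h := (hasSum_polyaCoeff r (z := x) (by simpa [abs_of_nonneg h0] using h1)).summable.norm
  refine h.congr fun k => ?_
  rw [norm_mul, norm_pow, Complex.norm_real, Complex.norm_real, Real.norm_eq_abs,
    Real.norm_eq_abs, abs_of_nonneg h0]

theorem hasSum_negBinomCoeff_real (r : ℝ) {x : ℝ} (h0 : 0 ≤ x) (h1 : x < 1) :
    HasSum (fun k : ℕ => negBinomCoeff r k * x ^ k) ((1 + x) ^ (-r)) := by
  have h := hasSum_negBinomCoeff r (z := x) (by simpa [abs_of_nonneg h0] using h1)
  rw [← Complex.ofReal_one, ← Complex.ofReal_add, ← Complex.ofReal_cpow (by positivity)] at h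
  exact_mod_cast h

theorem betaFn_one_left {κ : ℝ} (hκ : 0 < κ) : betaFn 1 κ = 1 / κ := by
  have := (Real.Gamma_pos_of_pos hκ).ne'
  rw [betaFn, Real.Gamma_one, add_comm, Real.Gamma_add_one hκ.ne']
  field_simp

theorem polyaWeight_one_left {κ : ℝ} (hκ : 0 < κ) (k : ℕ) :
    polyaWeight 1 κ k = κ * (negBinomCoeff (1 + κ) k * ((1 + κ) / 2 + k)) := by
  rw [polyaWeight, betaFn_one_left hκ, negBinomCoeff]
  field_simp

theorem Phi_eq_gaussian (x : ℝ) : Phi x = ∫ t in Iic x, gaussianPDFReal 0 1 t := by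
  unfold Phi gaussianPDFReal
  congr with t
  congr 1
  · rw [NNReal.coe_one, mul_one, Real.sqrt_eq_rpow, ← Real.rpow_neg (by positivity)]
    norm_num
  · simp

theorem Phi_eq_cdf : Phi = fun x => cdf (gaussianReal 0 1) x := by
  ext x
  rw [cdf_eq_real, measureReal_def, gaussianReal_apply_eq_integral _ one_ne_zero,
    ENNReal.toReal_ofReal, Phi_eq_gaussian]
  exact integral_nonneg fun t => gaussianPDFReal_nonneg _ _ _

theorem tendsto_Phi_atTop : Tendsto Phi atTop (𝓝 1) := by
  rw [Phi_eq_cdf]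
  exact tendsto_cdf_atTop _

theorem tendsto_Phi_atBot : Tendsto Phi atBot (𝓝 0) := by
  rw [Phi_eq_cdf]
  exact tendsto_cdf_atBot _

theorem Phi_nonneg (x : ℝ) : 0 ≤ Phi x := by
  rw [Phi_eq_cdf]
  exact cdf_nonneg _ _

theorem Phi_le_one (x : ℝ) : Phi x ≤ 1 := by
  rw [Phi_eq_cdf]
  exact cdf_le_one _ _

/-- The standard normal density. -/
noncomputable def normalDensity (t : ℝ) : ℝ :=
  (2 * Real.pi) ^ (-(1 : ℝ) / 2) * Real.exp (-t ^ 2 / 2)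

theorem normalDensity_nonneg (t : ℝ) : 0 ≤ normalDensity t := by
  unfold normalDensity
  positivity

@[fun_prop]
theorem continuous_normalDensity : Continuous normalDensity := by
  unfold normalDensity
  fun_prop

theorem integrable_normalDensity : Integrable normalDensity := by
  have := (integrable_exp_neg_mul_sq (b := 1 / 2) (by norm_num)).const_mul
    ((2 * Real.pi) ^ (-(1 : ℝ) / 2))
  refine this.congr (ae_of_all _ fun t => ?_)
  simp only [normalDensity]
  ring_nf

theorem hasDerivAt_Phi (x : ℝ) : HasDerivAt Phi (normalDensity x) x := by
  have h : Phi = fun y => Phi 0 + ∫ t in (0 : ℝ)..y, normalDensity t := by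
    ext y
    have := intervalIntegral.integral_Iic_sub_Iic (f := normalDensity) (a := 0) (b := y)
      integrable_normalDensity.integrableOn integrable_normalDensity.integrableOn
    rw [← this]
    change _ = Phi 0 + (Phi y - Phi 0)
    ring
  rw [h]
  exact (continuous_normalDensity.integral_hasStrictDerivAt 0 x).hasDerivAt.const_add _

/-- The density at `x` of the normal law with mean `-c * l` and variance `l`. -/
noncomputable def driftDensity (c x l : ℝ) : ℝ :=
  normalDensity ((x + c * l) / √l) / √l

theorem driftDensity_nonneg (c x l : ℝ) : 0 ≤ driftDensity c x l :=
  div_nonneg (normalDensity_nonneg _) (Real.sqrt_nonneg _)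

theorem measurable_driftDensity (c : ℝ) :
    Measurable fun p : ℝ × ℝ => driftDensity c p.1 p.2 := by
  unfold driftDensity
  fun_prop

theorem tendsto_Phi_affine (c : ℝ) {l : ℝ} (hl : 0 < l) :
    Tendsto (fun x => Phi ((x + c * l) / √l)) atBot (𝓝 0) := by
  refine tendsto_Phi_atBot.comp ?_
  exact (tendsto_atBot_add_const_right _ _ tendsto_id).atBot_div_const (Real.sqrt_pos.2 hl)

theorem integrableOn_driftDensity (c y : ℝ) {l : ℝ} (hl : 0 < l) :
    IntegrableOn (fun x => driftDensity c x l) (Iic y) := by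
  have h := integrable_normalDensity.comp_div (Real.sqrt_pos.2 hl).ne' |>.comp_add_right (c * l)
  exact (h.div_const _).integrableOn

theorem integral_driftDensity (c y : ℝ) {l : ℝ} (hl : 0 < l) :
    ∫ x in Iic y, driftDensity c x l = Phi ((y + c * l) / √l) := by
  rw [integral_Iic_of_hasDerivAt_of_tendsto' (f := fun x => Phi ((x + c * l) / √l)) (m := 0) _
    (integrableOn_driftDensity c y hl) (tendsto_Phi_affine c hl), sub_zero]
  intro x _
  have h := (hasDerivAt_Phi ((x + c * l) / √l)).comp x
    (((hasDerivAt_id x).add_const (c * l)).div_const (√l))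
  exact h.congr_deriv (by rw [driftDensity, mul_one_div])

theorem normalDensity_exp_mul (x s l : ℝ) (hl : 0 < l) :
    Real.exp (-(x * s)) * normalDensity ((s * l - x) / √l) =
      normalDensity 0 * Real.exp (-(x ^ 2 / (2 * l)) - s ^ 2 * l / 2) := by
  have h : -(x * s) + -((s * l - x) / √l) ^ 2 / 2 = -(x ^ 2 / (2 * l)) - s ^ 2 * l / 2 := by
    rw [div_pow, Real.sq_sqrt hl.le]
    field_simp
    ring
  rw [normalDensity, mul_left_comm, ← Real.exp_add, h]
  simp [normalDensity]

theorem hasDerivAt_Phi_pair (x s : ℝ) {l : ℝ} (hl : 0 < l) :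
    HasDerivAt (fun l => Real.exp (-(x * s)) * Phi ((s * l - x) / √l)
        - Real.exp (x * s) * Phi ((-x - s * l) / √l))
      (s * (normalDensity 0 * Real.exp (-(x ^ 2 / (2 * l)) - s ^ 2 * l / 2) / √l)) l := by
  have hs := Real.sqrt_pos.2 hl
  have hq : HasDerivAt (fun l => √l) (1 / (2 * √l)) l := by
    simpa using (hasDerivAt_id l).sqrt hl.ne'
  have e1 : HasDerivAt (fun l => (s * l - x) / √l)
      ((s * √l - (s * l - x) * (1 / (2 * √l))) / √l ^ 2) l := by
    simpa using (((hasDerivAt_id l).const_mul s).sub_const x).fun_div hq hs.ne'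
  have e2 : HasDerivAt (fun l => (-x - s * l) / √l)
      ((-s * √l - (-x - s * l) * (1 / (2 * √l))) / √l ^ 2) l := by
    simpa using (((hasDerivAt_id l).const_mul s).const_sub (-x)).fun_div hq hs.ne'
  have f1 := ((hasDerivAt_Phi _).comp l e1).const_mul (Real.exp (-(x * s)))
  have f2 := ((hasDerivAt_Phi _).comp l e2).const_mul (Real.exp (x * s))
  refine (f1.sub f2).congr_deriv ?_
  have n1 := normalDensity_exp_mul x s l hl
  have n2 := normalDensity_exp_mul x (-s) l hl
  rw [mul_neg, neg_neg, neg_sq, neg_mul, show -(s * l) - x = -x - s * l by ring] at n2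
  rw [← mul_assoc, n1, ← mul_assoc (Real.exp (x * s)), n2]
  generalize normalDensity 0 * Real.exp (-(x ^ 2 / (2 * l)) - s ^ 2 * l / 2) = N
  have : l = √l ^ 2 := (Real.sq_sqrt hl.le).symm
  clear f1 f2 n1 n2 e1 e2 hq
  generalize √l = w at *
  subst this
  field_simp
  ring

theorem integral_exp_inv_add (x s : ℝ) (hx : 0 < x) (hs : 0 < s) :
    IntegrableOn (fun l => normalDensity 0 * Real.exp (-(x ^ 2 / (2 * l)) - s ^ 2 * l / 2) / √l)
      (Ioi 0) ∧
    ∫ l in Ioi 0, normalDensity 0 * Real.exp (-(x ^ 2 / (2 * l)) - s ^ 2 * l / 2) / √l =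
      Real.exp (-(x * s)) / s := by
  set D : ℝ → ℝ := fun l => Real.exp (-(x * s)) * Phi ((s * l - x) / √l)
        - Real.exp (x * s) * Phi ((-x - s * l) / √l) with hD
  set f : ℝ → ℝ := fun l =>
    normalDensity 0 * Real.exp (-(x ^ 2 / (2 * l)) - s ^ 2 * l / 2) / √l with hf
  have hinv : Tendsto (fun l : ℝ => 1 / √l) (𝓝[>] 0) atTop := by
    have : Tendsto (fun l : ℝ => √l) (𝓝[>] 0) (𝓝[>] 0) := by
      refine tendsto_nhdsWithin_iff.2 ⟨?_, ?_⟩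
      · have h := Real.continuous_sqrt.tendsto 0
        rw [Real.sqrt_zero] at h
        exact h.mono_left nhdsWithin_le_nhds
      · filter_upwards [self_mem_nhdsWithin] with l hl using Real.sqrt_pos.2 hl
    simpa [Function.comp_def] using tendsto_inv_nhdsGT_zero.comp this
  have hlin : ∀ a : ℝ, Tendsto (fun l : ℝ => (a * l - x) / √l) (𝓝[>] 0) atBot := by
    intro a
    have h1 : Tendsto (fun l : ℝ => a * l - x) (𝓝[>] 0) (𝓝 (-x)) := by
      have : Tendsto (fun l : ℝ => a * l - x) (𝓝 0) (𝓝 (a * 0 - x)) :=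
        Continuous.tendsto (by fun_prop) 0
      simpa using this.mono_left nhdsWithin_le_nhds
    have := h1.neg_mul_atTop (by linarith) hinv
    simpa [div_eq_mul_inv] using this
  have h0 : Tendsto D (𝓝[>] 0) (𝓝 0) := by
    have h1 := (tendsto_Phi_atBot.comp (hlin s)).const_mul (Real.exp (-(x * s)))
    have h2 := (tendsto_Phi_atBot.comp (hlin (-s))).const_mul (Real.exp (x * s))
    have := h1.sub h2
    simp only [mul_zero, sub_zero] at this
    refine this.congr fun l => ?_
    simp only [hD, Function.comp_apply]
    ring_nf
  have hsq : Tendsto (fun l : ℝ => √l) atTop atTop := Real.tendsto_sqrt_atTop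
  have hdiv : Tendsto (fun l : ℝ => x / √l) atTop (𝓝 0) := hsq.const_div_atTop x
  have hT : Tendsto D atTop (𝓝 (Real.exp (-(x * s)))) := by
    have a1 : Tendsto (fun l : ℝ => (s * l - x) / √l) atTop atTop := by
      have : Tendsto (fun l : ℝ => s * √l + -(x / √l)) atTop atTop :=
        (hsq.const_mul_atTop hs).atTop_add hdiv.neg
      refine this.congr' ?_
      filter_upwards [eventually_gt_atTop 0] with l hl
      rw [sub_div, mul_div_assoc, Real.div_sqrt, sub_eq_add_neg]
    have a2 : Tendsto (fun l : ℝ => (-x - s * l) / √l) atTop atBot := by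
      have : Tendsto (fun l : ℝ => -(s * √l + (x / √l))) atTop atBot :=
        tendsto_neg_atTop_atBot.comp ((hsq.const_mul_atTop hs).atTop_add hdiv)
      refine this.congr' ?_
      filter_upwards [eventually_gt_atTop 0] with l hl
      rw [sub_div, mul_div_assoc, Real.div_sqrt]
      ring
    have h1 := (tendsto_Phi_atTop.comp a1).const_mul (Real.exp (-(x * s)))
    have h2 := (tendsto_Phi_atBot.comp a2).const_mul (Real.exp (x * s))
    simpa [hD, Function.comp_def] using h1.sub h2
  have hcont : ContinuousWithinAt (Function.update D 0 0) (Ici 0) 0 := by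
    rw [continuousWithinAt_update_same]
    simpa using h0
  have hderiv : ∀ l ∈ Ioi (0 : ℝ), HasDerivAt (Function.update D 0 0) (s * f l) l := by
    intro l hl
    refine (hasDerivAt_Phi_pair x s hl).congr_of_eventuallyEq ?_
    filter_upwards [lt_mem_nhds hl] with m hm
    rw [Function.update_of_ne (ne_of_gt hm)]
  have hpos : ∀ l ∈ Ioi (0 : ℝ), 0 ≤ s * f l := by
    intro l _
    have := normalDensity_nonneg 0
    simp only [hf]
    positivity
  have hT' : Tendsto (Function.update D 0 0) atTop (𝓝 (Real.exp (-(x * s)))) := by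
    refine hT.congr' ?_
    filter_upwards [eventually_gt_atTop 0] with l hl
    rw [Function.update_of_ne hl.ne']
  have hint := integrableOn_Ioi_deriv_of_nonneg hcont hderiv hpos hT'
  have hval := integral_Ioi_of_hasDerivAt_of_nonneg hcont hderiv hpos hT'
  constructor
  · have := hint.const_mul s⁻¹
    simpa [IntegrableOn, hs.ne'] using this
  · rw [integral_const_mul] at hval
    simp at hval
    field_simp
    linarith

theorem norm_one_add_exp_rpow_le {a t p : ℝ} {n : ℕ} (ha : 0 < a) (ha1 : a ≤ 1) (hp : 0 ≤ p)
    (hpn : p ≤ n) :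
    ‖1 + Complex.exp (-a * (1 - Complex.I * t))‖ ^ (-p) ≤ 1 + (2 * |t|) ^ n := by
  set z := Complex.exp (-a * (1 - Complex.I * t)) with hz
  have hre : z.re = Real.exp (-a) * Real.cos (a * t) := by
    simp [hz, Complex.exp_re]
  have hnorm : ‖z‖ = Real.exp (-a) := by
    simp [hz, Complex.norm_exp]
  have hpow : 0 ≤ (2 * |t|) ^ n := by positivity
  rcases le_or_gt 1 ‖1 + z‖ with h | h
  · linarith [Real.rpow_le_one_of_one_le_of_nonpos h (neg_nonpos.2 hp)]
  have hta : 1 < |t| * a := by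
    by_contra! hcon
    have habs : |a * t| ≤ 1 := by rwa [abs_mul, abs_of_pos ha, mul_comm]
    have hcos : 0 ≤ Real.cos (a * t) := by
      have := abs_le.1 habs
      apply Real.cos_nonneg_of_mem_Icc
      constructor <;> linarith [Real.pi_gt_three]
    have h1 : 1 ≤ (1 + z).re := by
      rw [Complex.add_re, Complex.one_re, hre]
      have := mul_nonneg (Real.exp_pos (-a)).le hcos
      linarith
    linarith [Complex.re_le_norm (1 + z)]
  have hlow : a / 2 ≤ ‖1 + z‖ := by
    have h1 : 1 - ‖z‖ ≤ ‖1 + z‖ := by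
      have := norm_sub_norm_le (1 : ℂ) (-z)
      simpa using this
    have h2 : Real.exp (-a) ≤ 1 - a / 2 := by
      rw [Real.exp_neg]
      have h3 : a + 1 ≤ Real.exp a := Real.add_one_le_exp a
      refine (inv_anti₀ (by linarith) h3).trans ?_
      rw [inv_le_iff_one_le_mul₀ (by linarith)]
      nlinarith
    linarith
  have hy : 0 < ‖1 + z‖ := by linarith
  have h1 : ‖1 + z‖ ^ (-p) ≤ ‖1 + z‖ ^ (-(n : ℝ)) :=
    Real.rpow_le_rpow_of_exponent_ge hy h.le (by linarith)
  have h2 : ‖1 + z‖ ^ (-(n : ℝ)) = (‖1 + z‖⁻¹) ^ n := by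
    rw [Real.rpow_neg hy.le, Real.rpow_natCast, inv_pow]
  have h3 : ‖1 + z‖⁻¹ ≤ 2 * |t| := by
    rw [inv_le_iff_one_le_mul₀ hy]
    nlinarith [abs_nonneg t]
  have h4 : (‖1 + z‖⁻¹) ^ n ≤ (2 * |t|) ^ n := by gcongr
  linarith

theorem integral_cexp_gaussianReal (s a : ℝ) :
    ∫ t, Complex.exp (-(s * a) * (1 - Complex.I * t)) * Complex.exp (1 / 2 - Complex.I * t)
      ∂(gaussianReal 0 1) = (Real.exp (-(s ^ 2 * a ^ 2 / 2)) : ℂ) := by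
  have h := charFun_gaussianReal (μ := 0) (v := 1) (s * a - 1)
  rw [charFun_apply_real] at h
  have h' : ∀ t : ℝ, Complex.exp (-(s * a) * (1 - Complex.I * t)) *
      Complex.exp (1 / 2 - Complex.I * t) =
      Complex.exp (1 / 2 - s * a) * Complex.exp (((s * a - 1 : ℝ) : ℂ) * t * Complex.I) := by
    intro t
    rw [← Complex.exp_add, ← Complex.exp_add]
    push_cast
    ring_nf
  simp_rw [h']
  rw [integral_const_mul, h, ← Complex.exp_add, Complex.ofReal_exp]
  push_cast
  ring_nf

theorem exists_bound_gaussian_series {r : ℝ} (hr : 0 < r) :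
    ∃ C : ℝ, ∀ l : ℝ, 0 < l → l ≤ 1 →
      |∑' k : ℕ, negBinomCoeff r k * (r / 2 + k) * Real.exp (-((r / 2 + k) ^ 2 * l / 2))| ≤ C := by
  obtain ⟨n, hn⟩ := exists_nat_ge (r + 1)
  refine ⟨∫ t, 2 * (2 * r * (1 + (2 * |t|) ^ n)) ∂(gaussianReal 0 1), fun l hl hl1 => ?_⟩
  set a := √l with ha
  have ha0 : 0 < a := Real.sqrt_pos.2 hl
  have ha1 : a ≤ 1 := Real.sqrt_le_one.2 hl1
  have ha2 : a ^ 2 = l := Real.sq_sqrt hl.le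
  set A : ℕ → ℝ := fun k => negBinomCoeff r k * (r / 2 + k) with hA
  set F : ℕ → ℝ → ℂ := fun k t => A k *
    (Complex.exp (-(((r / 2 + k : ℝ) : ℂ) * a) * (1 - Complex.I * t)) *
      Complex.exp (1 / 2 - Complex.I * t)) with hF
  have hnormF : ∀ k t, ‖F k t‖ = |A k| * Real.exp (1 / 2 - r / 2 * a) * Real.exp (-a) ^ k := by
    intro k t
    simp only [hF, norm_mul, Complex.norm_exp, Complex.norm_real, Real.norm_eq_abs, mul_assoc]
    rw [← Real.exp_add, ← Real.exp_nat_mul, ← Real.exp_add]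
    congr 2
    simp
    ring
  have hFint : ∀ k, Integrable (F k) (gaussianReal 0 1) := by
    intro k
    refine Integrable.of_bound (Continuous.aestronglyMeasurable (by fun_prop)) _
      (ae_of_all _ fun t => (hnormF k t).le)
  have hexp : Real.exp (-a) < 1 := Real.exp_lt_one_iff.2 (by linarith)
  have hFsum : Summable fun k => ∫ t, ‖F k t‖ ∂(gaussianReal 0 1) := by
    simp only [hnormF, integral_const, probReal_univ, one_smul]
    refine ((summable_abs_polyaCoeff r (Real.exp_pos (-a)).le hexp).mul_left
      (Real.exp (1 / 2 - r / 2 * a))).congr fun k => ?_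
    ring
  have hsum := hasSum_integral_of_summable_integral_norm hFint hFsum
  have hval : ∀ k, ∫ t, F k t ∂(gaussianReal 0 1) =
      ((A k * Real.exp (-((r / 2 + k) ^ 2 * l / 2)) : ℝ) : ℂ) := by
    intro k
    simp only [hF]
    rw [integral_const_mul, integral_cexp_gaussianReal, ha2]
    push_cast
    rfl
  simp only [hval] at hsum
  have hreal : ((∑' k : ℕ, A k * Real.exp (-((r / 2 + k) ^ 2 * l / 2)) : ℝ) : ℂ) =
      ∫ t, ∑' k, F k t ∂(gaussianReal 0 1) := by
    rw [← hsum.tsum_eq, Complex.ofReal_tsum]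
  rw [← Real.norm_eq_abs, ← Complex.norm_real, hreal]
  refine norm_integral_le_of_norm_le ?_ (ae_of_all _ fun t => ?_)
  · have : Integrable (fun t : ℝ => |t| ^ n) (gaussianReal 0 1) :=
      (memLp_id_gaussianReal (μ := 0) (v := 1) n).integrable_norm_pow'
    simp only [mul_pow]
    exact (((integrable_const (1 : ℝ)).add (this.const_mul (2 ^ n))).const_mul _).const_mul _
  · set z := Complex.exp (-a * (1 - Complex.I * t)) with hz
    have hzn : ‖z‖ = Real.exp (-a) := by simp [hz, Complex.norm_exp]
    have hz1 : ‖z‖ < 1 := by rw [hzn]; exact hexp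
    set w := Complex.exp (-((r / 2 : ℝ) * a) * (1 - Complex.I * t)) *
      Complex.exp (1 / 2 - Complex.I * t) with hw
    have hFz : ∀ k, F k t = (A k : ℂ) * z ^ k * w := by
      intro k
      simp only [hF, hz, hw]
      simp only [← Complex.exp_nat_mul, mul_assoc (A k : ℂ), ← Complex.exp_add]
      congr 2
      push_cast
      ring
    have hwn : ‖w‖ ≤ 2 := by
      simp only [hw, norm_mul, Complex.norm_exp]
      rw [← Real.exp_add]
      have h1 : Real.exp (1 / 2) ≤ 2 := by
        have : Real.exp (1 / 2) ^ 2 = Real.exp 1 := by rw [← Real.exp_nat_mul]; norm_num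
        nlinarith [Real.exp_one_lt_d9, Real.exp_pos (1 / 2)]
      refine (Real.exp_le_exp.2 ?_).trans h1
      simp
      positivity
    simp only [hFz]
    rw [tsum_mul_right, (hasSum_polyaCoeff r hz1).tsum_eq, norm_mul, mul_comm]
    have b1 := norm_one_add_exp_rpow_le (t := t) (p := r) (n := n) ha0 ha1 hr.le (by linarith)
    have b2 := norm_one_add_exp_rpow_le (t := t) (p := r + 1) (n := n) ha0 ha1 (by linarith) hn
    rw [← hz] at b1 b2
    have hH : ‖(r / 2 : ℂ) * (1 + z) ^ ((-r : ℝ) : ℂ) - r * z * (1 + z) ^ ((-(r + 1) : ℝ) : ℂ)‖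
        ≤ 2 * r * (1 + (2 * |t|) ^ n) := by
      refine (norm_sub_le _ _).trans ?_
      simp only [norm_mul, Complex.norm_cpow_real, norm_div, Complex.norm_real, Real.norm_eq_abs,
        abs_of_pos hr, Complex.norm_ofNat]
      have e1 : r / 2 * ‖1 + z‖ ^ (-r) ≤ r * (1 + (2 * |t|) ^ n) := by
        gcongr
        linarith
      have e2 : r * ‖z‖ * ‖1 + z‖ ^ (-(r + 1)) ≤ r * 1 * (1 + (2 * |t|) ^ n) := by
        gcongr
      linarith
    gcongr

theorem summable_abs_polyaWeight {κ l : ℝ} (hκ : 0 < κ) (hl : 0 < l) :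
    Summable fun k : ℕ => |polyaWeight 1 κ k * Real.exp (-((1 + k) * (κ + k) * l / 2))| := by
  have h := (summable_abs_polyaCoeff (1 + κ) (Real.exp_pos (-(l / 2))).le
    (Real.exp_lt_one_iff.2 (by linarith))).mul_left κ
  refine Summable.of_nonneg_of_le (fun _ => abs_nonneg _) (fun k => ?_) h
  rw [polyaWeight_one_left hκ, abs_mul, abs_mul, abs_of_pos hκ, Real.abs_exp, mul_assoc]
  gcongr
  rw [← Real.exp_nat_mul, Real.exp_le_exp]
  have : (k : ℝ) ≤ (1 + k) * (κ + k) := by nlinarith [Nat.cast_nonneg (α := ℝ) k]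
  nlinarith

theorem polya_one_left_eq {κ : ℝ} (hκ : 0 < κ) (l : ℝ) :
    polya 1 κ l = κ * Real.exp (((1 - κ) / 2) ^ 2 * l / 2) *
      ∑' k : ℕ, negBinomCoeff (1 + κ) k * ((1 + κ) / 2 + k) *
        Real.exp (-(((1 + κ) / 2 + k) ^ 2 * l / 2)) := by
  rw [polya, ← tsum_mul_left]
  congr with k
  rw [polyaWeight_one_left hκ, show -((1 + k) * (κ + k) * l / 2) =
    ((1 - κ) / 2) ^ 2 * l / 2 + -(((1 + κ) / 2 + k) ^ 2 * l / 2) by ring, Real.exp_add]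
  ring

theorem aestronglyMeasurable_polya {κ : ℝ} (hκ : 0 < κ) :
    AEStronglyMeasurable (polya 1 κ) (volume.restrict (Ioi 0)) := by
  refine aestronglyMeasurable_of_tendsto_ae atTop
    (f := fun (n : ℕ) l => ∑ k ∈ Finset.range n,
      polyaWeight 1 κ k * Real.exp (-((1 + k) * (κ + k) * l / 2))) (fun n => ?_) ?_
  · exact Continuous.aestronglyMeasurable (by fun_prop)
  · filter_upwards [ae_restrict_mem measurableSet_Ioi] with l hl
    exact (summable_abs_polyaWeight hκ hl).of_abs.hasSum.tendsto_sum_nat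

theorem integrableOn_polya {κ : ℝ} (hκ : 0 < κ) : IntegrableOn (polya 1 κ) (Ioi 0) := by
  have hm := aestronglyMeasurable_polya hκ
  rw [← Ioc_union_Ioi_eq_Ioi zero_le_one]
  refine IntegrableOn.union ?_ ?_
  · obtain ⟨C, hC⟩ := exists_bound_gaussian_series (r := 1 + κ) (by linarith)
    refine IntegrableOn.of_bound (by simp) (hm.mono_set Ioc_subset_Ioi_self)
      (κ * Real.exp (((1 - κ) / 2) ^ 2 * 1 / 2) * C) ?_
    filter_upwards [ae_restrict_mem measurableSet_Ioc] with l hl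
    rw [polya_one_left_eq hκ, Real.norm_eq_abs, abs_mul, abs_mul, abs_of_pos hκ, Real.abs_exp]
    have := hC l hl.1 hl.2
    have := hl.2
    gcongr
  · set S := ∑' k : ℕ, |polyaWeight 1 κ k * Real.exp (-((1 + k) * (κ + k) * 1 / 2))|
    have hg : IntegrableOn (fun l => S * Real.exp (κ / 2) * Real.exp (-(κ / 2) * l)) (Ioi 1) :=
      (exp_neg_integrableOn_Ioi 1 (by positivity)).const_mul _
    refine hg.mono' (hm.mono_set (Ioi_subset_Ioi zero_le_one)) ?_
    filter_upwards [ae_restrict_mem measurableSet_Ioi] with l hl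
    rw [mem_Ioi] at hl
    have hs1 := summable_abs_polyaWeight hκ one_pos
    have hle : ∀ k : ℕ, |polyaWeight 1 κ k * Real.exp (-((1 + k) * (κ + k) * l / 2))| ≤
        |polyaWeight 1 κ k * Real.exp (-((1 + k) * (κ + k) * 1 / 2))| *
          Real.exp (κ / 2 + -(κ / 2) * l) := by
      intro k
      rw [abs_mul, abs_mul, Real.abs_exp, Real.abs_exp, mul_assoc |_|, ← Real.exp_add]
      gcongr
      have : κ ≤ (1 + k) * (κ + k) := by
        nlinarith [Nat.cast_nonneg (α := ℝ) k, mul_nonneg hκ.le (Nat.cast_nonneg (α := ℝ) k)]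
      nlinarith
    rw [polya, mul_assoc, ← Real.exp_add]
    exact tsum_of_norm_bounded (hs1.hasSum.mul_right _) hle

theorem driftDensity_mul_exp (κ x : ℝ) (k : ℕ) {l : ℝ} (hl : 0 < l) :
    driftDensity (1 / 2 * (1 - κ)) x l * Real.exp (-((1 + k) * (κ + k) * l / 2)) =
      Real.exp (-(1 / 2 * (1 - κ) * x)) * (normalDensity 0 *
        Real.exp (-(|x| ^ 2 / (2 * l)) - ((1 + κ) / 2 + k) ^ 2 * l / 2) / √l) := by
  have h : -((x + 1 / 2 * (1 - κ) * l) / √l) ^ 2 / 2 + -((1 + k) * (κ + k) * l / 2) =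
      -(1 / 2 * (1 - κ) * x) + (-(|x| ^ 2 / (2 * l)) - ((1 + κ) / 2 + k) ^ 2 * l / 2) := by
    rw [div_pow, Real.sq_sqrt hl.le, sq_abs]
    field_simp
    ring
  rw [driftDensity, normalDensity, div_mul_eq_mul_div, mul_assoc, ← Real.exp_add, h, Real.exp_add]
  simp [normalDensity]
  ring

theorem integral_driftDensity_mul_polya {κ x : ℝ} (hκ : 0 < κ) (hx : x ≠ 0) :
    ∫ l in Ioi 0, driftDensity (1 / 2 * (1 - κ)) x l * polya 1 κ l =
      κ * Real.exp (-x) * (1 + Real.exp (-x)) ^ (-(1 + κ)) := by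
  set c := 1 / 2 * (1 - κ) with hc
  set F : ℕ → ℝ → ℝ := fun k l => driftDensity c x l *
    (polyaWeight 1 κ k * Real.exp (-((1 + k) * (κ + k) * l / 2))) with hF
  set E : ℕ → ℝ → ℝ := fun k l => normalDensity 0 *
        Real.exp (-(|x| ^ 2 / (2 * l)) - ((1 + κ) / 2 + k) ^ 2 * l / 2) / √l with hE
  have hs : ∀ k : ℕ, 0 < (1 + κ) / 2 + (k : ℝ) := fun k => by positivity
  have hEF : ∀ k, ∀ l ∈ Ioi (0 : ℝ),
      F k l = polyaWeight 1 κ k * Real.exp (-(c * x)) * E k l := by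
    intro k l hl
    simp only [hF, hE]
    rw [mul_left_comm, driftDensity_mul_exp κ x k hl, ← mul_assoc]
  have hEI := fun k : ℕ => integral_exp_inv_add |x| ((1 + κ) / 2 + k) (abs_pos.2 hx) (hs k)
  have hE0 : ∀ k l, 0 ≤ E k l := fun k l => by
    have := normalDensity_nonneg 0
    simp only [hE]
    positivity
  have hFint : ∀ k, IntegrableOn (F k) (Ioi 0) := fun k =>
    IntegrableOn.congr_fun ((hEI k).1.const_mul _) (fun l hl => (hEF k l hl).symm)
      measurableSet_Ioi
  have hexp : ∀ k : ℕ, Real.exp (-(|x| * ((1 + κ) / 2 + k))) =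
      Real.exp (-(|x| * ((1 + κ) / 2))) * Real.exp (-|x|) ^ k := by
    intro k
    rw [← Real.exp_nat_mul, ← Real.exp_add]
    ring_nf
  have hFval : ∀ k, ∫ l in Ioi 0, F k l =
      κ * Real.exp (-(c * x)) * Real.exp (-(|x| * ((1 + κ) / 2))) *
        (negBinomCoeff (1 + κ) k * Real.exp (-|x|) ^ k) := by
    intro k
    rw [setIntegral_congr_fun measurableSet_Ioi (hEF k), integral_const_mul, (hEI k).2, hexp,
      polyaWeight_one_left hκ]
    have := (hs k).ne'
    field_simp
  have hFnorm : ∀ k, ∫ l in Ioi 0, ‖F k l‖ =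
      κ * Real.exp (-(c * x)) * Real.exp (-(|x| * ((1 + κ) / 2))) *
        (|negBinomCoeff (1 + κ) k| * Real.exp (-|x|) ^ k) := by
    intro k
    have h : ∀ l ∈ Ioi (0 : ℝ), ‖F k l‖ = |polyaWeight 1 κ k| * Real.exp (-(c * x)) * E k l := by
      intro l hl
      rw [hEF k l hl, Real.norm_eq_abs, abs_mul, abs_mul, Real.abs_exp, abs_of_nonneg (hE0 k l)]
    rw [setIntegral_congr_fun measurableSet_Ioi h, integral_const_mul, (hEI k).2, hexp,
      polyaWeight_one_left hκ, abs_mul, abs_mul, abs_of_pos hκ, abs_of_pos (hs k)]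
    have := (hs k).ne'
    field_simp
  have hlt : Real.exp (-|x|) < 1 := Real.exp_lt_one_iff.2 (by simpa using hx)
  have hsum := hasSum_integral_of_summable_integral_norm hFint (by
    simp only [hFnorm]
    exact (summable_abs_negBinomCoeff _ (Real.exp_pos _).le hlt).mul_left _)
  simp only [hFval] at hsum
  have hsum' := (hasSum_negBinomCoeff_real (1 + κ) (Real.exp_pos (-|x|)).le hlt).mul_left
    (κ * Real.exp (-(c * x)) * Real.exp (-(|x| * ((1 + κ) / 2))))
  have heq := hsum.unique hsum'
  simp only [hF, tsum_mul_left] at heq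
  change ∫ l in Ioi 0, driftDensity c x l * polya 1 κ l = _ at heq
  rw [heq, mul_assoc κ, mul_assoc κ, mul_assoc κ, ← Real.exp_add]
  congr 1
  rcases lt_or_gt_of_ne hx with h | h
  · rw [abs_of_neg h, neg_neg]
    have h1 : 1 + Real.exp (-x) = Real.exp (-x) * (1 + Real.exp x) := by
      rw [mul_add, ← Real.exp_add]
      simp [add_comm]
    rw [h1, Real.mul_rpow (Real.exp_pos _).le (by positivity), ← Real.exp_mul, ← mul_assoc,
      ← Real.exp_add]
    congr 2
    rw [hc]
    ring
  · rw [abs_of_pos h]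
    congr 2
    rw [hc]
    ring

theorem hasDerivAt_logistic_rpow (κ x : ℝ) :
    HasDerivAt (fun x => (1 + Real.exp (-x)) ^ (-κ))
      (κ * Real.exp (-x) * (1 + Real.exp (-x)) ^ (-(1 + κ))) x := by
  have h : HasDerivAt (fun x => 1 + Real.exp (-x)) (-Real.exp (-x)) x := by
    simpa using ((hasDerivAt_id x).neg.exp).const_add 1
  refine (h.rpow_const (p := -κ) (Or.inl (by positivity))).congr_deriv ?_
  rw [show -κ - 1 = -(1 + κ) by ring]
  ring

theorem tendsto_logistic_rpow_atBot {κ : ℝ} (hκ : 0 < κ) :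
    Tendsto (fun x => (1 + Real.exp (-x)) ^ (-κ)) atBot (𝓝 0) :=
  (tendsto_rpow_neg_atTop hκ).comp
    (tendsto_atTop_add_const_left _ _ (Real.tendsto_exp_atTop.comp tendsto_neg_atBot_atTop))

theorem integrable_driftDensity_mul_polya {κ : ℝ} (hκ : 0 < κ) (μ : ℝ) :
    Integrable (Function.uncurry fun x l => driftDensity (1 / 2 * (1 - κ)) x l * polya 1 κ l)
      ((volume.restrict (Iic μ)).prod (volume.restrict (Ioi 0))) := by
  have hm : AEStronglyMeasurable
      (Function.uncurry fun x l => driftDensity (1 / 2 * (1 - κ)) x l * polya 1 κ l)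
      ((volume.restrict (Iic μ)).prod (volume.restrict (Ioi 0))) :=
    (measurable_driftDensity _).aestronglyMeasurable.mul (aestronglyMeasurable_polya hκ).comp_snd
  rw [integrable_prod_iff' hm]
  constructor
  · filter_upwards [ae_restrict_mem measurableSet_Ioi] with l hl
    exact (integrableOn_driftDensity (1 / 2 * (1 - κ)) μ hl).mul_const (polya 1 κ l)
  · refine (integrableOn_polya hκ).norm.mono' hm.norm.prod_swap.integral_prod_right' ?_
    filter_upwards [ae_restrict_mem measurableSet_Ioi] with l hl
    have h : ∀ x, ‖Function.uncurry (fun x l => driftDensity (1 / 2 * (1 - κ)) x l * polya 1 κ l)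
        (x, l)‖ = driftDensity (1 / 2 * (1 - κ)) x l * ‖polya 1 κ l‖ := fun x => by
      simp [abs_of_nonneg (driftDensity_nonneg _ _ _)]
    simp only [h]
    rw [integral_mul_const, integral_driftDensity _ _ hl, norm_mul, norm_norm, Real.norm_eq_abs,
      abs_of_nonneg (Phi_nonneg _)]
    exact mul_le_of_le_one_left (norm_nonneg _) (Phi_le_one _)

/-- Alternate single-integral representation of the powered logistic function:
`(1 + e^{-μ})^{-κ} = ∫_0^∞ Φ((μ + (1/2)(1-κ)λ)/√λ) q_{1,κ}(λ) dλ`. -/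
theorem logistic_power_phi_representation (κ μ : ℝ) (hκ : 0 < κ) :
    (1 + Real.exp (-μ)) ^ (-κ) =
      ∫ lam in Set.Ioi (0 : ℝ),
        Phi ((μ + (1 / 2) * (1 - κ) * lam) / Real.sqrt lam) * polya 1 κ lam := by
  have hint := integrable_driftDensity_mul_polya hκ μ
  have hne : ∀ᵐ x ∂(volume.restrict (Iic μ)), x ≠ 0 := ae_restrict_of_ae (by simp [ae_iff])
  have hae : ∀ᵐ x ∂(volume.restrict (Iic μ)),
      ∫ l in Ioi 0, driftDensity (1 / 2 * (1 - κ)) x l * polya 1 κ l =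
        κ * Real.exp (-x) * (1 + Real.exp (-x)) ^ (-(1 + κ)) := by
    filter_upwards [hne] with x hx using integral_driftDensity_mul_polya hκ hx
  have hleft := integral_Iic_of_hasDerivAt_of_tendsto' (a := μ)
    (fun x _ => hasDerivAt_logistic_rpow κ x) (hint.integral_prod_left.congr hae)
    (tendsto_logistic_rpow_atBot hκ)
  rw [sub_zero, ← integral_congr_ae hae, integral_integral_swap hint] at hleft
  rw [← hleft]
  refine setIntegral_congr_fun measurableSet_Ioi fun l hl => ?_
  simp only [integral_mul_const, integral_driftDensity _ _ hl]
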